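/- arXiv:2602.16880 — 4 statements merged into one kernel-verified Lean document; each statement's English description precedes it below -/
import Mathlib

section
/- Every rule of the sequent calculi G4CK and G4WK is order-reducing: for every instance of every rule of G4CK and of G4WK, each premise is strictly smaller than the conclusion in the order ≺ on sequents, and ≺ is a well-founded order; consequently naive backward proof-search in G4CK and in G4WK strongly terminates. -/
/-- Formulas of the modal language: φ ::= p | ⊥ | φ∧φ | φ∨φ | φ→φ | □φ | ◇φ. -/
inductive Form : Type
  | var : ℕ → Form
  | bot : Form
  | and : Form → Form → Form
  | or  : Form → Form → Form
  | imp : Form → Form → Form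
  | box : Form → Form
  | dia : Form → Form
  deriving DecidableEq

/-- Helper for □⁻¹: remove an outer box. -/
def unboxF : Form → Option Form
  | Form.box φ => some φ
  | _ => none

/-- □⁻¹Γ := {φ | □φ ∈ Γ}, as a multiset operation. -/
def boxInv (Γ : Multiset Form) : Multiset Form := Γ.filterMap unboxF

/-- ◇⁻¹Δ for a succedent Δ with at most one formula (modelled by `Option`). -/
def diaInv : Option Form → Option Form
  | some (Form.dia φ) => some φ
  | _ => none

/-- Provability in the sequent calculus G4CK: sequents Γ ⇒ δ with a
multiset antecedent and a single-formula succedent. -/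
inductive G4CK : Multiset Form → Form → Prop
  | botL (Γ δ) : G4CK (Form.bot ::ₘ Γ) δ
  | idP (Γ n) : G4CK (Form.var n ::ₘ Γ) (Form.var n)
  | andL (Γ φ ψ δ) : G4CK (φ ::ₘ ψ ::ₘ Γ) δ → G4CK (Form.and φ ψ ::ₘ Γ) δ
  | andR (Γ φ ψ) : G4CK Γ φ → G4CK Γ ψ → G4CK Γ (Form.and φ ψ)
  | orL (Γ φ ψ δ) : G4CK (φ ::ₘ Γ) δ → G4CK (ψ ::ₘ Γ) δ → G4CK (Form.or φ ψ ::ₘ Γ) δ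
  | orR1 (Γ φ ψ) : G4CK Γ φ → G4CK Γ (Form.or φ ψ)
  | orR2 (Γ φ ψ) : G4CK Γ ψ → G4CK Γ (Form.or φ ψ)
  | impR (Γ φ ψ) : G4CK (φ ::ₘ Γ) ψ → G4CK Γ (Form.imp φ ψ)
  | andImpL (Γ φ ψ χ δ) :
      G4CK (Form.imp φ (Form.imp ψ χ) ::ₘ Γ) δ →
      G4CK (Form.imp (Form.and φ ψ) χ ::ₘ Γ) δ
  | orImpL (Γ φ ψ χ δ) :
      G4CK (Form.imp φ χ ::ₘ Form.imp ψ χ ::ₘ Γ) δ →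
      G4CK (Form.imp (Form.or φ ψ) χ ::ₘ Γ) δ
  | pImpL (Γ n φ δ) :
      G4CK (Form.var n ::ₘ φ ::ₘ Γ) δ →
      G4CK (Form.var n ::ₘ Form.imp (Form.var n) φ ::ₘ Γ) δ
  | impImpL (Γ φ ψ χ δ) :
      G4CK (Form.imp ψ χ ::ₘ Γ) (Form.imp φ ψ) → G4CK (χ ::ₘ Γ) δ →
      G4CK (Form.imp (Form.imp φ ψ) χ ::ₘ Γ) δ
  | boxR (Γ φ) : G4CK (boxInv Γ) φ → G4CK Γ (Form.box φ)
  | boxImpL (Γ φ ψ δ) :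
      G4CK (boxInv Γ) φ → G4CK (ψ ::ₘ Γ) δ →
      G4CK (Form.imp (Form.box φ) ψ ::ₘ Γ) δ
  | diaImpL (Γ γ φ ψ δ) :
      G4CK (γ ::ₘ boxInv Γ) φ → G4CK (ψ ::ₘ Form.dia γ ::ₘ Γ) δ →
      G4CK (Form.imp (Form.dia φ) ψ ::ₘ Form.dia γ ::ₘ Γ) δ
  | diaL (Γ φ ψ) : G4CK (φ ::ₘ boxInv Γ) ψ → G4CK (Form.dia φ ::ₘ Γ) (Form.dia ψ)

/-- Provability in the sequent calculus G4WK: sequents Γ ⇒ Δ with a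
multiset antecedent and a succedent with at most one formula (`Option Form`). -/
inductive G4WK : Multiset Form → Option Form → Prop
  | botL (Γ Δ) : G4WK (Form.bot ::ₘ Γ) Δ
  | idP (Γ n) : G4WK (Form.var n ::ₘ Γ) (some (Form.var n))
  | andL (Γ φ ψ Δ) : G4WK (φ ::ₘ ψ ::ₘ Γ) Δ → G4WK (Form.and φ ψ ::ₘ Γ) Δ
  | andR (Γ φ ψ) : G4WK Γ (some φ) → G4WK Γ (some ψ) → G4WK Γ (some (Form.and φ ψ))
  | orL (Γ φ ψ Δ) : G4WK (φ ::ₘ Γ) Δ → G4WK (ψ ::ₘ Γ) Δ → G4WK (Form.or φ ψ ::ₘ Γ) Δ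
  | orR1 (Γ φ ψ) : G4WK Γ (some φ) → G4WK Γ (some (Form.or φ ψ))
  | orR2 (Γ φ ψ) : G4WK Γ (some ψ) → G4WK Γ (some (Form.or φ ψ))
  | impR (Γ φ ψ) : G4WK (φ ::ₘ Γ) (some ψ) → G4WK Γ (some (Form.imp φ ψ))
  | andImpL (Γ φ ψ χ Δ) :
      G4WK (Form.imp φ (Form.imp ψ χ) ::ₘ Γ) Δ →
      G4WK (Form.imp (Form.and φ ψ) χ ::ₘ Γ) Δ
  | orImpL (Γ φ ψ χ Δ) :
      G4WK (Form.imp φ χ ::ₘ Form.imp ψ χ ::ₘ Γ) Δ →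
      G4WK (Form.imp (Form.or φ ψ) χ ::ₘ Γ) Δ
  | pImpL (Γ n φ Δ) :
      G4WK (Form.var n ::ₘ φ ::ₘ Γ) Δ →
      G4WK (Form.var n ::ₘ Form.imp (Form.var n) φ ::ₘ Γ) Δ
  | impImpL (Γ φ ψ χ Δ) :
      G4WK (Form.imp ψ χ ::ₘ Γ) (some (Form.imp φ ψ)) → G4WK (χ ::ₘ Γ) Δ →
      G4WK (Form.imp (Form.imp φ ψ) χ ::ₘ Γ) Δ
  | boxR (Γ φ) : G4WK (boxInv Γ) (some φ) → G4WK Γ (some (Form.box φ))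
  | boxImpL (Γ φ ψ Δ) :
      G4WK (boxInv Γ) (some φ) → G4WK (ψ ::ₘ Γ) Δ →
      G4WK (Form.imp (Form.box φ) ψ ::ₘ Γ) Δ
  | diaImpL (Γ γ φ ψ Δ) :
      G4WK (γ ::ₘ boxInv Γ) (some φ) → G4WK (ψ ::ₘ Form.dia γ ::ₘ Γ) Δ →
      G4WK (Form.imp (Form.dia φ) ψ ::ₘ Form.dia γ ::ₘ Γ) Δ
  | diaL' (Γ φ Δ) : G4WK (φ ::ₘ boxInv Γ) (diaInv Δ) → G4WK (Form.dia φ ::ₘ Γ) Δ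

/-- Axiom schemes of the generalised Hilbert calculus CKH:
intuitionistic axioms A1–A9 together with K_□ and K_◇. -/
inductive CKAx : Form → Prop
  | a1 (φ ψ : Form) : CKAx (φ.imp (ψ.imp φ))
  | a2 (φ ψ χ : Form) : CKAx ((φ.imp (ψ.imp χ)).imp ((φ.imp ψ).imp (φ.imp χ)))
  | a3 (φ ψ : Form) : CKAx (φ.imp (φ.or ψ))
  | a4 (φ ψ : Form) : CKAx (ψ.imp (φ.or ψ))
  | a5 (φ ψ χ : Form) : CKAx ((φ.imp χ).imp ((ψ.imp χ).imp ((φ.or ψ).imp χ)))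
  | a6 (φ ψ : Form) : CKAx ((φ.and ψ).imp φ)
  | a7 (φ ψ : Form) : CKAx ((φ.and ψ).imp ψ)
  | a8 (φ ψ χ : Form) : CKAx ((φ.imp ψ).imp ((φ.imp χ).imp (φ.imp (ψ.and χ))))
  | a9 (φ : Form) : CKAx (Form.bot.imp φ)
  | kbox (φ ψ : Form) : CKAx ((φ.imp ψ).box.imp (φ.box.imp ψ.box))
  | kdia (φ ψ : Form) : CKAx ((φ.imp ψ).box.imp (φ.dia.imp ψ.dia))

/-- Axiom schemes of WKH: those of CKH together with N : ¬◇⊥. -/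
inductive WKAx : Form → Prop
  | ck {φ : Form} : CKAx φ → WKAx φ
  | n : WKAx (Form.bot.dia.imp Form.bot)

/-- Derivability Γ ⊢ φ in the generalised Hilbert calculus CKH. -/
inductive CKH : Set Form → Form → Prop
  | ax {Γ : Set Form} {φ : Form} : CKAx φ → CKH Γ φ
  | el {Γ : Set Form} {φ : Form} : φ ∈ Γ → CKH Γ φ
  | mp {Γ : Set Form} {φ ψ : Form} : CKH Γ φ → CKH Γ (φ.imp ψ) → CKH Γ ψ
  | nec {Γ : Set Form} {φ : Form} : CKH ∅ φ → CKH Γ φ.box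

/-- Derivability Γ ⊢ φ in the generalised Hilbert calculus WKH. -/
inductive WKH : Set Form → Form → Prop
  | ax {Γ : Set Form} {φ : Form} : WKAx φ → WKH Γ φ
  | el {Γ : Set Form} {φ : Form} : φ ∈ Γ → WKH Γ φ
  | mp {Γ : Set Form} {φ ψ : Form} : WKH Γ φ → WKH Γ (φ.imp ψ) → WKH Γ ψ
  | nec {Γ : Set Form} {φ : Form} : WKH ∅ φ → WKH Γ φ.box

/-- The set of propositional variables occurring in a formula. -/
def vars : Form → Set ℕ
  | .var n => {n}
  | .bot => ∅
  | .and φ ψ => vars φ ∪ vars ψ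
  | .or φ ψ => vars φ ∪ vars ψ
  | .imp φ ψ => vars φ ∪ vars ψ
  | .box φ => vars φ
  | .dia φ => vars φ

/-- Variables occurring in a multiset of formulas. -/
def varsM (Γ : Multiset Form) : Set ℕ := {n | ∃ φ ∈ Γ, n ∈ vars φ}

/-- Variables occurring in a succedent with at most one formula. -/
def varsO : Option Form → Set ℕ
  | none => ∅
  | some φ => vars φ

/-- Weight of a formula: w(⊥)=w(p)=1, w(ψ∨χ)=w(ψ→χ)=w(ψ)+w(χ)+1,
w(ψ∧χ)=w(ψ)+w(χ)+2, w(□ψ)=w(◇ψ)=w(ψ)+1. -/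
def weight : Form → ℕ
  | .var _ => 1
  | .bot => 1
  | .and φ ψ => weight φ + weight ψ + 2
  | .or φ ψ => weight φ + weight ψ + 1
  | .imp φ ψ => weight φ + weight ψ + 1
  | .box φ => weight φ + 1
  | .dia φ => weight φ + 1

/-- φ ≺_f ψ iff w(φ) < w(ψ). -/
def fLT (φ ψ : Form) : Prop := weight φ < weight ψ

/-- The Dershowitz–Manna multiset extension ≺_m of ≺_f:
A ≺_m B iff A is obtained from B by replacing a non-empty sub-multiset Z
of B by finitely many elements each strictly ≺_f-smaller than some
element of Z. -/
def mLT (A B : Multiset Form) : Prop :=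
  ∃ X Y Z : Multiset Form,
    Z ≠ 0 ∧ B = X + Z ∧ A = X + Y ∧ ∀ y ∈ Y, ∃ z ∈ Z, fLT y z

/-- The order ≺ on G4CK sequents: Γ ⇒ δ ≺ Π ⇒ σ iff Γ⊎{δ} ≺_m Π⊎{σ}. -/
def seqCKLT (s t : Multiset Form × Form) : Prop :=
  mLT (s.2 ::ₘ s.1) (t.2 ::ₘ t.1)

/-- The multiset contributed by a succedent with at most one formula. -/
def toM : Option Form → Multiset Form
  | none => 0
  | some φ => {φ}

/-- The order ≺ on G4WK sequents: Γ ⇒ Δ ≺ Π ⇒ Σ iff Γ⊎Δ ≺_m Π⊎Σ,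
where an empty succedent contributes nothing. -/
def seqWKLT (s t : Multiset Form × Option Form) : Prop :=
  mLT (s.1 + toM s.2) (t.1 + toM t.2)

/-- `StepCK s t` holds iff `s` is a premise of an instance of a rule of
G4CK with conclusion `t` (one constructor per premise of each rule). -/
inductive StepCK : Multiset Form × Form → Multiset Form × Form → Prop
  | andL (Γ φ ψ δ) : StepCK (φ ::ₘ ψ ::ₘ Γ, δ) (Form.and φ ψ ::ₘ Γ, δ)
  | andR1 (Γ φ ψ) : StepCK (Γ, φ) (Γ, Form.and φ ψ)
  | andR2 (Γ φ ψ) : StepCK (Γ, ψ) (Γ, Form.and φ ψ)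
  | orL1 (Γ φ ψ δ) : StepCK (φ ::ₘ Γ, δ) (Form.or φ ψ ::ₘ Γ, δ)
  | orL2 (Γ φ ψ δ) : StepCK (ψ ::ₘ Γ, δ) (Form.or φ ψ ::ₘ Γ, δ)
  | orR1 (Γ φ ψ) : StepCK (Γ, φ) (Γ, Form.or φ ψ)
  | orR2 (Γ φ ψ) : StepCK (Γ, ψ) (Γ, Form.or φ ψ)
  | impR (Γ φ ψ) : StepCK (φ ::ₘ Γ, ψ) (Γ, Form.imp φ ψ)
  | andImpL (Γ φ ψ χ δ) :
      StepCK (Form.imp φ (Form.imp ψ χ) ::ₘ Γ, δ) (Form.imp (Form.and φ ψ) χ ::ₘ Γ, δ)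
  | orImpL (Γ φ ψ χ δ) :
      StepCK (Form.imp φ χ ::ₘ Form.imp ψ χ ::ₘ Γ, δ) (Form.imp (Form.or φ ψ) χ ::ₘ Γ, δ)
  | pImpL (Γ n φ δ) :
      StepCK (Form.var n ::ₘ φ ::ₘ Γ, δ) (Form.var n ::ₘ Form.imp (Form.var n) φ ::ₘ Γ, δ)
  | impImpL1 (Γ φ ψ χ δ) :
      StepCK (Form.imp ψ χ ::ₘ Γ, Form.imp φ ψ) (Form.imp (Form.imp φ ψ) χ ::ₘ Γ, δ)
  | impImpL2 (Γ φ ψ χ δ) :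
      StepCK (χ ::ₘ Γ, δ) (Form.imp (Form.imp φ ψ) χ ::ₘ Γ, δ)
  | boxR (Γ φ) : StepCK (boxInv Γ, φ) (Γ, Form.box φ)
  | boxImpL1 (Γ φ ψ δ) :
      StepCK (boxInv Γ, φ) (Form.imp (Form.box φ) ψ ::ₘ Γ, δ)
  | boxImpL2 (Γ φ ψ δ) :
      StepCK (ψ ::ₘ Γ, δ) (Form.imp (Form.box φ) ψ ::ₘ Γ, δ)
  | diaImpL1 (Γ γ φ ψ δ) :
      StepCK (γ ::ₘ boxInv Γ, φ) (Form.imp (Form.dia φ) ψ ::ₘ Form.dia γ ::ₘ Γ, δ)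
  | diaImpL2 (Γ γ φ ψ δ) :
      StepCK (ψ ::ₘ Form.dia γ ::ₘ Γ, δ) (Form.imp (Form.dia φ) ψ ::ₘ Form.dia γ ::ₘ Γ, δ)
  | diaL (Γ φ ψ) : StepCK (φ ::ₘ boxInv Γ, ψ) (Form.dia φ ::ₘ Γ, Form.dia ψ)

/-- `StepWK s t` holds iff `s` is a premise of an instance of a rule of
G4WK with conclusion `t` (one constructor per premise of each rule). -/
inductive StepWK : Multiset Form × Option Form → Multiset Form × Option Form → Prop
  | andL (Γ φ ψ Δ) : StepWK (φ ::ₘ ψ ::ₘ Γ, Δ) (Form.and φ ψ ::ₘ Γ, Δ)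
  | andR1 (Γ φ ψ) : StepWK (Γ, some φ) (Γ, some (Form.and φ ψ))
  | andR2 (Γ φ ψ) : StepWK (Γ, some ψ) (Γ, some (Form.and φ ψ))
  | orL1 (Γ φ ψ Δ) : StepWK (φ ::ₘ Γ, Δ) (Form.or φ ψ ::ₘ Γ, Δ)
  | orL2 (Γ φ ψ Δ) : StepWK (ψ ::ₘ Γ, Δ) (Form.or φ ψ ::ₘ Γ, Δ)
  | orR1 (Γ φ ψ) : StepWK (Γ, some φ) (Γ, some (Form.or φ ψ))
  | orR2 (Γ φ ψ) : StepWK (Γ, some ψ) (Γ, some (Form.or φ ψ))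
  | impR (Γ φ ψ) : StepWK (φ ::ₘ Γ, some ψ) (Γ, some (Form.imp φ ψ))
  | andImpL (Γ φ ψ χ Δ) :
      StepWK (Form.imp φ (Form.imp ψ χ) ::ₘ Γ, Δ) (Form.imp (Form.and φ ψ) χ ::ₘ Γ, Δ)
  | orImpL (Γ φ ψ χ Δ) :
      StepWK (Form.imp φ χ ::ₘ Form.imp ψ χ ::ₘ Γ, Δ) (Form.imp (Form.or φ ψ) χ ::ₘ Γ, Δ)
  | pImpL (Γ n φ Δ) :
      StepWK (Form.var n ::ₘ φ ::ₘ Γ, Δ) (Form.var n ::ₘ Form.imp (Form.var n) φ ::ₘ Γ, Δ)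
  | impImpL1 (Γ φ ψ χ Δ) :
      StepWK (Form.imp ψ χ ::ₘ Γ, some (Form.imp φ ψ)) (Form.imp (Form.imp φ ψ) χ ::ₘ Γ, Δ)
  | impImpL2 (Γ φ ψ χ Δ) :
      StepWK (χ ::ₘ Γ, Δ) (Form.imp (Form.imp φ ψ) χ ::ₘ Γ, Δ)
  | boxR (Γ φ) : StepWK (boxInv Γ, some φ) (Γ, some (Form.box φ))
  | boxImpL1 (Γ φ ψ Δ) :
      StepWK (boxInv Γ, some φ) (Form.imp (Form.box φ) ψ ::ₘ Γ, Δ)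
  | boxImpL2 (Γ φ ψ Δ) :
      StepWK (ψ ::ₘ Γ, Δ) (Form.imp (Form.box φ) ψ ::ₘ Γ, Δ)
  | diaImpL1 (Γ γ φ ψ Δ) :
      StepWK (γ ::ₘ boxInv Γ, some φ) (Form.imp (Form.dia φ) ψ ::ₘ Form.dia γ ::ₘ Γ, Δ)
  | diaImpL2 (Γ γ φ ψ Δ) :
      StepWK (ψ ::ₘ Form.dia γ ::ₘ Γ, Δ) (Form.imp (Form.dia φ) ψ ::ₘ Form.dia γ ::ₘ Γ, Δ)
  | diaL' (Γ φ Δ) : StepWK (φ ::ₘ boxInv Γ, diaInv Δ) (Form.dia φ ::ₘ Γ, Δ)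

/-- Replacing one formula by finitely many strictly lighter ones decreases a multiset. -/
theorem mLT_of_replace {A B : Multiset Form} (X Y : Multiset Form) (z : Form)
    (hA : A = X + Y) (hB : B = X + {z}) (h : ∀ y ∈ Y, weight y < weight z) : mLT A B :=
  ⟨X, Y, {z}, by simp, hB, hA, fun y hy => ⟨z, by simp, h y hy⟩⟩

/-- A multiset all of whose members are strictly dominated in a non-empty multiset is smaller. -/
theorem mLT_of_forall_exists_lt {A B : Multiset Form} (hB : B ≠ 0)
    (h : ∀ y ∈ A, ∃ z ∈ B, weight y < weight z) : mLT A B :=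
  ⟨0, A, B, hB, by simp, by simp, h⟩

theorem mem_boxInv {Γ : Multiset Form} {φ : Form} : φ ∈ boxInv Γ ↔ φ.box ∈ Γ := by
  rw [boxInv, Multiset.mem_filterMap]
  constructor
  · rintro ⟨a, ha, h⟩
    cases a <;> simp_all [unboxF]
  · exact fun h => ⟨_, h, rfl⟩

theorem mem_toM {Δ : Option Form} {φ : Form} : φ ∈ toM Δ ↔ Δ = some φ := by
  cases Δ <;> simp [toM, eq_comm]

theorem diaInv_eq_some {Δ : Option Form} {φ : Form} :
    diaInv Δ = some φ ↔ Δ = some φ.dia := by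
  rcases Δ with _ | a
  · simp [diaInv]
  · cases a <;> simp [diaInv]

/-- The unboxed antecedent is dominated by the antecedent, so a modal premise is smaller as soon
as its remaining formulas are dominated. -/
theorem mLT_boxInv_add {Γ A B : Multiset Form} (hB : B ≠ 0)
    (hA : ∀ y ∈ A, ∃ z ∈ Γ + B, weight y < weight z) : mLT (boxInv Γ + A) (Γ + B) := by
  refine mLT_of_forall_exists_lt (by simp [hB]) fun y hy => ?_
  rcases Multiset.mem_add.1 hy with hy | hy
  · exact ⟨y.box, Multiset.mem_add.2 (.inl (mem_boxInv.1 hy)), by simp [weight]⟩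
  · exact hA y hy

theorem StepWK.seqWKLT {s t : Multiset Form × Option Form} (h : StepWK s t) : seqWKLT s t := by
  unfold _root_.seqWKLT
  cases h with
  | andL Γ φ ψ Δ =>
    refine mLT_of_replace (Γ + toM Δ) {φ, ψ} (φ.and ψ) ?_ ?_ ?_
    · simp only [← Multiset.singleton_add, Multiset.insert_eq_cons]; abel
    · simp only [← Multiset.singleton_add]; abel
    · simp [weight]; omega
  | andR1 Γ φ ψ => exact mLT_of_replace Γ {φ} (φ.and ψ) rfl rfl (by simp [weight]; omega)
  | andR2 Γ φ ψ => exact mLT_of_replace Γ {ψ} (φ.and ψ) rfl rfl (by simp [weight]; omega)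
  | orL1 Γ φ ψ Δ =>
    refine mLT_of_replace (Γ + toM Δ) {φ} (φ.or ψ) ?_ ?_ (by simp [weight]) <;>
      simp only [← Multiset.singleton_add] <;> abel
  | orL2 Γ φ ψ Δ =>
    refine mLT_of_replace (Γ + toM Δ) {ψ} (φ.or ψ) ?_ ?_ (by simp [weight]) <;>
      simp only [← Multiset.singleton_add] <;> abel
  | orR1 Γ φ ψ => exact mLT_of_replace Γ {φ} (φ.or ψ) rfl rfl (by simp [weight])
  | orR2 Γ φ ψ => exact mLT_of_replace Γ {ψ} (φ.or ψ) rfl rfl (by simp [weight])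
  | impR Γ φ ψ =>
    refine mLT_of_replace Γ {φ, ψ} (φ.imp ψ) ?_ rfl (by simp [weight])
    simp only [toM, ← Multiset.singleton_add, Multiset.insert_eq_cons]; abel
  | andImpL Γ φ ψ χ Δ =>
    refine mLT_of_replace (Γ + toM Δ) {φ.imp (ψ.imp χ)} ((φ.and ψ).imp χ) ?_ ?_
      (by simp [weight]; omega) <;>
      simp only [← Multiset.singleton_add] <;> abel
  | orImpL Γ φ ψ χ Δ =>
    refine mLT_of_replace (Γ + toM Δ) {φ.imp χ, ψ.imp χ} ((φ.or ψ).imp χ) ?_ ?_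
      (by simp [weight]) <;>
      simp only [← Multiset.singleton_add, Multiset.insert_eq_cons] <;> abel
  | pImpL Γ n φ Δ =>
    refine mLT_of_replace (.var n ::ₘ Γ + toM Δ) {φ} ((Form.var n).imp φ) ?_ ?_
      (by simp [weight]) <;>
      simp only [← Multiset.singleton_add] <;> abel
  | impImpL1 Γ φ ψ χ Δ =>
    refine ⟨Γ, {ψ.imp χ, φ.imp ψ}, {(φ.imp ψ).imp χ} + toM Δ, by simp, ?_, ?_, ?_⟩
    · simp only [← Multiset.singleton_add]; abel
    · simp only [toM, ← Multiset.singleton_add, Multiset.insert_eq_cons]; abel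
    · refine fun y hy => ⟨(φ.imp ψ).imp χ, by simp, ?_⟩
      simp only [Multiset.insert_eq_cons, Multiset.mem_cons, Multiset.mem_singleton] at hy
      rcases hy with rfl | rfl <;> simp only [fLT, weight] <;> omega
  | impImpL2 Γ φ ψ χ Δ =>
    refine mLT_of_replace (Γ + toM Δ) {χ} ((φ.imp ψ).imp χ) ?_ ?_ (by simp [weight]) <;>
      simp only [← Multiset.singleton_add] <;> abel
  | boxR Γ φ => exact mLT_boxInv_add (by simp [toM]) (by simp [toM, weight])
  | boxImpL1 Γ φ ψ Δ =>
    rw [Multiset.cons_add, ← Multiset.add_cons]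
    refine mLT_boxInv_add (by simp) fun y hy => ⟨φ.box.imp ψ, by simp, ?_⟩
    obtain rfl : φ = y := by simpa [mem_toM] using hy
    simp only [weight]; omega
  | boxImpL2 Γ φ ψ Δ =>
    refine mLT_of_replace (Γ + toM Δ) {ψ} (φ.box.imp ψ) ?_ ?_ (by simp [weight]) <;>
      simp only [← Multiset.singleton_add] <;> abel
  | diaImpL1 Γ γ φ ψ Δ =>
    simp only [Multiset.cons_add]
    simp only [← Multiset.add_cons]
    refine mLT_boxInv_add (by simp) fun y hy => ?_
    rcases Multiset.mem_cons.1 hy with rfl | hy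
    · exact ⟨y.dia, by simp, by simp [weight]⟩
    · obtain rfl : φ = y := by simpa [mem_toM] using hy
      exact ⟨φ.dia.imp ψ, by simp, by simp only [weight]; omega⟩
  | diaImpL2 Γ γ φ ψ Δ =>
    refine mLT_of_replace (γ.dia ::ₘ Γ + toM Δ) {ψ} (φ.dia.imp ψ) ?_ ?_
      (by simp [weight]) <;>
      simp only [← Multiset.singleton_add] <;> abel
  | diaL' Γ φ Δ =>
    simp only [Multiset.cons_add]
    simp only [← Multiset.add_cons]
    refine mLT_boxInv_add (by simp) fun y hy => ?_
    rcases Multiset.mem_cons.1 hy with rfl | hy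
    · exact ⟨y.dia, by simp, by simp [weight]⟩
    · exact ⟨y.dia, by simp [mem_toM, diaInv_eq_some.1 (mem_toM.1 hy)], by simp [weight]⟩

/-- A single-conclusion sequent viewed as a sequent with at most one succedent formula. -/
def toWKSequent (s : Multiset Form × Form) : Multiset Form × Option Form :=
  (s.1, some s.2)

/-- Every rule instance of G4CK is a rule instance of G4WK. -/
theorem StepCK.toWKSequent {s t : Multiset Form × Form} (h : StepCK s t) :
    StepWK (toWKSequent s) (toWKSequent t) := by
  cases h with
  | diaL Γ φ ψ => exact .diaL' Γ φ (some ψ.dia)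
  | _ => constructor

theorem seqWKLT_toWKSequent {s t : Multiset Form × Form} :
    seqWKLT (toWKSequent s) (toWKSequent t) ↔ seqCKLT s t := by
  simp only [seqWKLT, seqCKLT, toWKSequent, toM, Multiset.add_comm _ {_},
    Multiset.singleton_add]

theorem mLT.isDershowitzMannaLT_map {A B : Multiset Form} (h : mLT A B) :
    Multiset.IsDershowitzMannaLT (A.map weight) (B.map weight) := by
  obtain ⟨X, Y, Z, hZ, rfl, rfl, h⟩ := h
  refine ⟨X.map weight, Y.map weight, Z.map weight, by simpa using hZ, by simp, by simp, ?_⟩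
  simpa [fLT] using h

theorem wellFounded_mLT : WellFounded mLT :=
  Subrelation.wf mLT.isDershowitzMannaLT_map
    (InvImage.wf (Multiset.map weight) Multiset.wellFounded_isDershowitzMannaLT)

theorem wellFounded_seqCKLT : WellFounded seqCKLT :=
  InvImage.wf (fun s : Multiset Form × Form => s.2 ::ₘ s.1) wellFounded_mLT

theorem wellFounded_seqWKLT : WellFounded seqWKLT :=
  InvImage.wf (fun s : Multiset Form × Option Form => s.1 + toM s.2) wellFounded_mLT

theorem StepCK.seqCKLT {s t : Multiset Form × Form} (h : StepCK s t) : seqCKLT s t :=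
  seqWKLT_toWKSequent.1 h.toWKSequent.seqWKLT

/-- Every rule of G4CK and of G4WK is order-reducing: each premise of
each rule instance is ≺-smaller than the conclusion; ≺ is well-founded
on sequents of both calculi; consequently naive backward proof-search
strongly terminates, i.e. the premise-of relation is well-founded. -/
theorem order_reducing_and_strong_termination :
    (∀ s t, StepCK s t → seqCKLT s t) ∧
    (∀ s t, StepWK s t → seqWKLT s t) ∧
    WellFounded seqCKLT ∧
    WellFounded seqWKLT ∧
    WellFounded StepCK ∧
    WellFounded StepWK :=
  ⟨fun _ _ => StepCK.seqCKLT, fun _ _ => StepWK.seqWKLT, wellFounded_seqCKLT,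
    wellFounded_seqWKLT, Subrelation.wf StepCK.seqCKLT wellFounded_seqCKLT,
    Subrelation.wf StepWK.seqWKLT wellFounded_seqWKLT⟩
end

section
/- The weakening rule is admissible in both G4CK and G4WK: for every finite multiset Π, if ⊢_G4CK Γ ⇒ Δ then ⊢_G4CK Γ,Π ⇒ Δ, and if ⊢_G4WK Γ ⇒ Δ then ⊢_G4WK Γ,Π ⇒ Δ. -/
theorem boxInv_add (Γ Θ : Multiset Form) : boxInv (Γ + Θ) = boxInv Γ + boxInv Θ :=
  Multiset.filterMap_add _ _ _

theorem G4CK.weakening {Γ : Multiset Form} {δ : Form} (h : G4CK Γ δ) (Θ : Multiset Form) :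
    G4CK (Γ + Θ) δ := by
  induction h generalizing Θ <;> try simp only [Multiset.cons_add] at *
  case botL => exact botL _ _
  case idP => exact idP _ _
  case andL ih => exact andL _ _ _ _ (ih Θ)
  case andR ih₁ ih₂ => exact andR _ _ _ (ih₁ Θ) (ih₂ Θ)
  case orL ih₁ ih₂ => exact orL _ _ _ _ (ih₁ Θ) (ih₂ Θ)
  case orR1 ih => exact orR1 _ _ _ (ih Θ)
  case orR2 ih => exact orR2 _ _ _ (ih Θ)
  case impR ih => exact impR _ _ _ (ih Θ)
  case andImpL ih => exact andImpL _ _ _ _ _ (ih Θ)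
  case orImpL ih => exact orImpL _ _ _ _ _ (ih Θ)
  case pImpL ih => exact pImpL _ _ _ _ (ih Θ)
  case impImpL ih₁ ih₂ => exact impImpL _ _ _ _ _ (ih₁ Θ) (ih₂ Θ)
  case boxR ih => exact boxR _ _ (boxInv_add _ _ ▸ ih (boxInv Θ))
  case boxImpL ih₁ ih₂ =>
    exact boxImpL _ _ _ _ (boxInv_add _ _ ▸ ih₁ (boxInv Θ)) (ih₂ Θ)
  case diaImpL ih₁ ih₂ =>
    exact diaImpL _ _ _ _ _ (boxInv_add _ _ ▸ ih₁ (boxInv Θ)) (ih₂ Θ)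
  case diaL ih => exact diaL _ _ _ (boxInv_add _ _ ▸ ih (boxInv Θ))

theorem G4WK.weakening {Γ : Multiset Form} {Δ : Option Form} (h : G4WK Γ Δ)
    (Θ : Multiset Form) : G4WK (Γ + Θ) Δ := by
  induction h generalizing Θ <;> try simp only [Multiset.cons_add] at *
  case botL => exact botL _ _
  case idP => exact idP _ _
  case andL ih => exact andL _ _ _ _ (ih Θ)
  case andR ih₁ ih₂ => exact andR _ _ _ (ih₁ Θ) (ih₂ Θ)
  case orL ih₁ ih₂ => exact orL _ _ _ _ (ih₁ Θ) (ih₂ Θ)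
  case orR1 ih => exact orR1 _ _ _ (ih Θ)
  case orR2 ih => exact orR2 _ _ _ (ih Θ)
  case impR ih => exact impR _ _ _ (ih Θ)
  case andImpL ih => exact andImpL _ _ _ _ _ (ih Θ)
  case orImpL ih => exact orImpL _ _ _ _ _ (ih Θ)
  case pImpL ih => exact pImpL _ _ _ _ (ih Θ)
  case impImpL ih₁ ih₂ => exact impImpL _ _ _ _ _ (ih₁ Θ) (ih₂ Θ)
  case boxR ih => exact boxR _ _ (boxInv_add _ _ ▸ ih (boxInv Θ))
  case boxImpL ih₁ ih₂ =>
    exact boxImpL _ _ _ _ (boxInv_add _ _ ▸ ih₁ (boxInv Θ)) (ih₂ Θ)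
  case diaImpL ih₁ ih₂ =>
    exact diaImpL _ _ _ _ _ (boxInv_add _ _ ▸ ih₁ (boxInv Θ)) (ih₂ Θ)
  case diaL' ih => exact diaL' _ _ _ (boxInv_add _ _ ▸ ih (boxInv Θ))

/-- The weakening rule is admissible in both G4CK and G4WK. -/
theorem weakening_admissible :
    (∀ (Γ Θ : Multiset Form) (δ : Form), G4CK Γ δ → G4CK (Γ + Θ) δ) ∧
    (∀ (Γ Θ : Multiset Form) (Δ : Option Form), G4WK Γ Δ → G4WK (Γ + Θ) Δ) :=
  ⟨fun _ Θ _ h => h.weakening Θ, fun _ Θ _ h => h.weakening Θ⟩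
end

section
/- The generalised identity rule is admissible in both G4CK and G4WK: for every finite multiset Γ and every formula φ, ⊢_G4CK Γ,φ ⇒ φ and ⊢_G4WK Γ,φ ⇒ φ. -/
/-- Identity in `G4CK`, together with admissibility of left implication from a formula `φ` that is
itself in the antecedent, for a premise that is stable under weakening. -/
theorem G4CK.identity_and_impL (φ : Form) :
    (∀ Γ, G4CK (φ ::ₘ Γ) φ) ∧
    (∀ (ψ : Form) (Γ : Multiset Form) (δ : Form), (∀ Γ', Γ ≤ Γ' → G4CK (ψ ::ₘ Γ') δ) →
      G4CK (φ ::ₘ Form.imp φ ψ ::ₘ Γ) δ) := by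
  induction φ with
  | var n =>
    refine ⟨fun Γ => .idP Γ n, fun ψ Γ δ h => .pImpL Γ n ψ δ ?_⟩
    rw [Multiset.cons_swap]
    exact h _ (Multiset.le_cons_self Γ _)
  | bot => exact ⟨fun Γ => .botL Γ _, fun ψ Γ δ _ => .botL _ δ⟩
  | and α β ihα ihβ =>
    refine ⟨fun Γ => .andL _ _ _ _ (.andR _ _ _ (ihα.1 _) ?_), fun ψ Γ δ h => .andL _ _ _ _ ?_⟩
    · rw [Multiset.cons_swap]
      exact ihβ.1 _
    · have key : G4CK (α ::ₘ Form.imp α (Form.imp β ψ) ::ₘ β ::ₘ Γ) δ := by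
        refine ihα.2 _ _ δ fun Γ' hΓ' => ?_
        obtain ⟨Θ, rfl⟩ := Multiset.le_iff_exists_add.1 hΓ'
        rw [Multiset.cons_add, Multiset.cons_swap]
        exact ihβ.2 _ _ δ fun Γ'' hΓ'' => h _ ((Multiset.le_add_right Γ Θ).trans hΓ'')
      have perm : α ::ₘ β ::ₘ Form.imp (Form.and α β) ψ ::ₘ Γ
          = Form.imp (Form.and α β) ψ ::ₘ α ::ₘ β ::ₘ Γ := by
        rw [Multiset.cons_swap β, Multiset.cons_swap α]
      rw [perm]
      refine .andImpL _ _ _ _ _ ?_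
      rwa [Multiset.cons_swap]
  | or α β ihα ihβ =>
    refine ⟨fun Γ => .orL _ _ _ _ (.orR1 _ _ _ (ihα.1 _)) (.orR2 _ _ _ (ihβ.1 _)),
      fun ψ Γ δ h => ?_⟩
    rw [Multiset.cons_swap]
    refine .orImpL _ _ _ _ _ ?_
    rw [Multiset.cons_swap _ (Form.or α β), Multiset.cons_swap _ (Form.or α β)]
    refine .orL _ _ _ _ ?_ ?_
    · exact ihα.2 _ _ δ fun Γ' hΓ' => h _ ((Multiset.le_cons_self Γ _).trans hΓ')
    · rw [Multiset.cons_swap (Form.imp α ψ)]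
      exact ihβ.2 _ _ δ fun Γ' hΓ' => h _ ((Multiset.le_cons_self Γ _).trans hΓ')
  | imp α β ihα ihβ =>
    have id_imp : ∀ Γ, G4CK (Form.imp α β ::ₘ Γ) (Form.imp α β) := fun Γ =>
      .impR _ _ _ (ihα.2 _ _ _ fun Γ' _ => ihβ.1 Γ')
    refine ⟨id_imp, fun ψ Γ δ h => ?_⟩
    rw [Multiset.cons_swap]
    refine .impImpL _ _ _ _ _ ?_ (h _ (Multiset.le_cons_self Γ _))
    rw [Multiset.cons_swap]
    exact id_imp _
  | box α ih =>
    have id_unbox : ∀ Γ, G4CK (boxInv (Form.box α ::ₘ Γ)) α := fun Γ => by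
      rw [boxInv, Multiset.filterMap_cons_some unboxF (Form.box α) Γ rfl]
      exact ih.1 _
    refine ⟨fun Γ => .boxR _ _ (id_unbox Γ), fun ψ Γ δ h => ?_⟩
    rw [Multiset.cons_swap]
    exact .boxImpL _ _ _ _ (id_unbox Γ) (h _ (Multiset.le_cons_self Γ _))
  | dia α ih =>
    refine ⟨fun Γ => .diaL _ _ _ (ih.1 _), fun ψ Γ δ h => ?_⟩
    rw [Multiset.cons_swap]
    exact .diaImpL _ _ _ _ _ (ih.1 _) (h _ (Multiset.le_cons_self Γ _))

/-- Identity in `G4WK`, together with admissibility of left implication from a formula `φ` that is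
itself in the antecedent, for a premise that is stable under weakening. -/
theorem G4WK.identity_and_impL (φ : Form) :
    (∀ Γ, G4WK (φ ::ₘ Γ) (some φ)) ∧
    (∀ (ψ : Form) (Γ : Multiset Form) (Δ : Option Form), (∀ Γ', Γ ≤ Γ' → G4WK (ψ ::ₘ Γ') Δ) →
      G4WK (φ ::ₘ Form.imp φ ψ ::ₘ Γ) Δ) := by
  induction φ with
  | var n =>
    refine ⟨fun Γ => .idP Γ n, fun ψ Γ Δ h => .pImpL Γ n ψ Δ ?_⟩
    rw [Multiset.cons_swap]
    exact h _ (Multiset.le_cons_self Γ _)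
  | bot => exact ⟨fun Γ => .botL Γ _, fun ψ Γ Δ _ => .botL _ Δ⟩
  | and α β ihα ihβ =>
    refine ⟨fun Γ => .andL _ _ _ _ (.andR _ _ _ (ihα.1 _) ?_), fun ψ Γ Δ h => .andL _ _ _ _ ?_⟩
    · rw [Multiset.cons_swap]
      exact ihβ.1 _
    · have key : G4WK (α ::ₘ Form.imp α (Form.imp β ψ) ::ₘ β ::ₘ Γ) Δ := by
        refine ihα.2 _ _ Δ fun Γ' hΓ' => ?_
        obtain ⟨Θ, rfl⟩ := Multiset.le_iff_exists_add.1 hΓ'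
        rw [Multiset.cons_add, Multiset.cons_swap]
        exact ihβ.2 _ _ Δ fun Γ'' hΓ'' => h _ ((Multiset.le_add_right Γ Θ).trans hΓ'')
      have perm : α ::ₘ β ::ₘ Form.imp (Form.and α β) ψ ::ₘ Γ
          = Form.imp (Form.and α β) ψ ::ₘ α ::ₘ β ::ₘ Γ := by
        rw [Multiset.cons_swap β, Multiset.cons_swap α]
      rw [perm]
      refine .andImpL _ _ _ _ _ ?_
      rwa [Multiset.cons_swap]
  | or α β ihα ihβ =>
    refine ⟨fun Γ => .orL _ _ _ _ (.orR1 _ _ _ (ihα.1 _)) (.orR2 _ _ _ (ihβ.1 _)),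
      fun ψ Γ Δ h => ?_⟩
    rw [Multiset.cons_swap]
    refine .orImpL _ _ _ _ _ ?_
    rw [Multiset.cons_swap _ (Form.or α β), Multiset.cons_swap _ (Form.or α β)]
    refine .orL _ _ _ _ ?_ ?_
    · exact ihα.2 _ _ Δ fun Γ' hΓ' => h _ ((Multiset.le_cons_self Γ _).trans hΓ')
    · rw [Multiset.cons_swap (Form.imp α ψ)]
      exact ihβ.2 _ _ Δ fun Γ' hΓ' => h _ ((Multiset.le_cons_self Γ _).trans hΓ')
  | imp α β ihα ihβ =>
    have id_imp : ∀ Γ, G4WK (Form.imp α β ::ₘ Γ) (some (Form.imp α β)) := fun Γ =>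
      .impR _ _ _ (ihα.2 _ _ _ fun Γ' _ => ihβ.1 Γ')
    refine ⟨id_imp, fun ψ Γ Δ h => ?_⟩
    rw [Multiset.cons_swap]
    refine .impImpL _ _ _ _ _ ?_ (h _ (Multiset.le_cons_self Γ _))
    rw [Multiset.cons_swap]
    exact id_imp _
  | box α ih =>
    have id_unbox : ∀ Γ, G4WK (boxInv (Form.box α ::ₘ Γ)) (some α) := fun Γ => by
      rw [boxInv, Multiset.filterMap_cons_some unboxF (Form.box α) Γ rfl]
      exact ih.1 _
    refine ⟨fun Γ => .boxR _ _ (id_unbox Γ), fun ψ Γ Δ h => ?_⟩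
    rw [Multiset.cons_swap]
    exact .boxImpL _ _ _ _ (id_unbox Γ) (h _ (Multiset.le_cons_self Γ _))
  | dia α ih =>
    refine ⟨fun Γ => .diaL' _ _ _ (ih.1 _), fun ψ Γ Δ h => ?_⟩
    rw [Multiset.cons_swap]
    exact .diaImpL _ _ _ _ _ (ih.1 _) (h _ (Multiset.le_cons_self Γ _))

/-- The generalised identity rule is admissible in both G4CK and G4WK:
Γ,φ ⇒ φ is provable for every multiset Γ and formula φ. -/
theorem generalised_identity_admissible :
    (∀ (Γ : Multiset Form) (φ : Form), G4CK (φ ::ₘ Γ) φ) ∧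
    (∀ (Γ : Multiset Form) (φ : Form), G4WK (φ ::ₘ Γ) (some φ)) := by
  exact ⟨fun Γ φ => (G4CK.identity_and_impL φ).1 Γ, fun Γ φ => (G4WK.identity_and_impL φ).1 Γ⟩
end

section
/- The contraction rule is admissible in both G4CK and G4WK: if ⊢ Γ,ψ,ψ ⇒ Δ then ⊢ Γ,ψ ⇒ Δ, where ⊢ is either ⊢_G4CK or ⊢_G4WK. -/
/-- A common presentation of the two calculi: for `w := True` it is G4WK, and for `w := False`
its sequents with nonempty succedent are those of G4CK. Side formulas that a left rule keeps are
expressed by membership. -/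
inductive G4 (w : Prop) : Multiset Form → Option Form → Prop
  | botL {Γ Δ} : Form.bot ∈ Γ → G4 w Γ Δ
  | idP {Γ n} : Form.var n ∈ Γ → G4 w Γ (some (Form.var n))
  | andL {Γ φ ψ Δ} : G4 w (φ ::ₘ ψ ::ₘ Γ) Δ → G4 w (Form.and φ ψ ::ₘ Γ) Δ
  | andR {Γ φ ψ} : G4 w Γ (some φ) → G4 w Γ (some ψ) → G4 w Γ (some (Form.and φ ψ))
  | orL {Γ φ ψ Δ} : G4 w (φ ::ₘ Γ) Δ → G4 w (ψ ::ₘ Γ) Δ → G4 w (Form.or φ ψ ::ₘ Γ) Δ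
  | orR1 {Γ φ ψ} : G4 w Γ (some φ) → G4 w Γ (some (Form.or φ ψ))
  | orR2 {Γ φ ψ} : G4 w Γ (some ψ) → G4 w Γ (some (Form.or φ ψ))
  | impR {Γ φ ψ} : G4 w (φ ::ₘ Γ) (some ψ) → G4 w Γ (some (Form.imp φ ψ))
  | andImpL {Γ φ ψ χ Δ} : G4 w (Form.imp φ (Form.imp ψ χ) ::ₘ Γ) Δ →
      G4 w (Form.imp (Form.and φ ψ) χ ::ₘ Γ) Δ
  | orImpL {Γ φ ψ χ Δ} : G4 w (Form.imp φ χ ::ₘ Form.imp ψ χ ::ₘ Γ) Δ →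
      G4 w (Form.imp (Form.or φ ψ) χ ::ₘ Γ) Δ
  | pImpL {Γ n φ Δ} : Form.var n ∈ Γ → G4 w (φ ::ₘ Γ) Δ →
      G4 w (Form.imp (Form.var n) φ ::ₘ Γ) Δ
  | impImpL {Γ φ ψ χ Δ} : G4 w (Form.imp ψ χ ::ₘ Γ) (some (Form.imp φ ψ)) →
      G4 w (χ ::ₘ Γ) Δ → G4 w (Form.imp (Form.imp φ ψ) χ ::ₘ Γ) Δ
  | boxR {Γ φ} : G4 w (boxInv Γ) (some φ) → G4 w Γ (some (Form.box φ))
  | boxImpL {Γ φ ψ Δ} : G4 w (boxInv Γ) (some φ) → G4 w (ψ ::ₘ Γ) Δ →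
      G4 w (Form.imp (Form.box φ) ψ ::ₘ Γ) Δ
  | diaImpL {Γ γ φ ψ Δ} : Form.dia γ ∈ Γ → G4 w (γ ::ₘ boxInv Γ) (some φ) →
      G4 w (ψ ::ₘ Γ) Δ → G4 w (Form.imp (Form.dia φ) ψ ::ₘ Γ) Δ
  | diaL {Γ φ Δ} : Form.dia φ ∈ Γ → (w ∨ (diaInv Δ).isSome) →
      G4 w (φ ::ₘ boxInv Γ) (diaInv Δ) → G4 w Γ Δ

theorem boxInv_mono {Γ Γ' : Multiset Form} (h : Γ ≤ Γ') : boxInv Γ ≤ boxInv Γ' :=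
  Multiset.filterMap_le_filterMap _ h

theorem boxInv_cons_box (A : Form) (Γ : Multiset Form) :
    boxInv (A.box ::ₘ Γ) = A ::ₘ boxInv Γ :=
  Multiset.filterMap_cons_some unboxF A.box Γ rfl

theorem boxInv_cons_of_unboxF {A : Form} (h : unboxF A = none) (Γ : Multiset Form) :
    boxInv (A ::ₘ Γ) = boxInv Γ :=
  Multiset.filterMap_cons_none A Γ h

@[simp] theorem boxInv_cons_imp (A B : Form) (Γ : Multiset Form) :
    boxInv (A.imp B ::ₘ Γ) = boxInv Γ :=
  boxInv_cons_of_unboxF rfl Γ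

@[simp] theorem boxInv_cons_dia (A : Form) (Γ : Multiset Form) :
    boxInv (A.dia ::ₘ Γ) = boxInv Γ :=
  boxInv_cons_of_unboxF rfl Γ

theorem le_boxInv_add {M Γ : Multiset Form} : boxInv Γ ≤ boxInv (M + Γ) :=
  boxInv_mono (Multiset.le_add_left _ _)

theorem exists_cons_of_cons_le {α : Type*} {a : α} {s t : Multiset α} (h : a ::ₘ s ≤ t) :
    ∃ u, t = a ::ₘ u ∧ s ≤ u := by
  obtain ⟨u, rfl⟩ := Multiset.exists_cons_of_mem (Multiset.mem_of_le h (Multiset.mem_cons_self a s))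
  exact ⟨u, rfl, (Multiset.cons_le_cons_iff a).1 h⟩

theorem cons_eq_cons_cons_self {α : Type*} {a b : α} {s t : Multiset α}
    (h : b ::ₘ s = a ::ₘ a ::ₘ t) :
    (b = a ∧ s = a ::ₘ t) ∨ ∃ u, s = a ::ₘ a ::ₘ u ∧ t = b ::ₘ u := by
  rcases Multiset.cons_eq_cons.1 h with h | ⟨hne, u, rfl, h'⟩
  · exact .inl h
  · rcases Multiset.cons_eq_cons.1 h' with ⟨rfl, -⟩ | ⟨-, v, rfl, rfl⟩
    · exact absurd rfl hne
    · exact .inr ⟨v, rfl, rfl⟩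

theorem cons_rotate_three {α : Type*} (a b c : α) (s : Multiset α) :
    a ::ₘ b ::ₘ c ::ₘ s = b ::ₘ c ::ₘ a ::ₘ s := by
  rw [Multiset.cons_swap a b, Multiset.cons_swap a c]

theorem cons_rotate_four {α : Type*} (a b c d : α) (s : Multiset α) :
    a ::ₘ b ::ₘ c ::ₘ d ::ₘ s = c ::ₘ d ::ₘ a ::ₘ b ::ₘ s := by
  rw [cons_rotate_three b c d, cons_rotate_three a c d]

namespace G4

variable {w : Prop}

theorem exch {Γ Γ' : Multiset Form} {Δ : Option Form} (h : G4 w Γ Δ)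
    (e : Γ = Γ' := by simp only [← Multiset.singleton_add]; ac_rfl) : G4 w Γ' Δ :=
  e ▸ h

/-- Weakening on the left. -/
theorem mono {Γ Γ' : Multiset Form} {Δ : Option Form} (h : G4 w Γ Δ) (hle : Γ ≤ Γ') :
    G4 w Γ' Δ := by
  induction h generalizing Γ' with
  | botL h => exact botL (Multiset.mem_of_le hle h)
  | idP h => exact idP (Multiset.mem_of_le hle h)
  | andR _ _ ih₁ ih₂ => exact andR (ih₁ hle) (ih₂ hle)
  | orR1 _ ih => exact orR1 (ih hle)
  | orR2 _ ih => exact orR2 (ih hle)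
  | impR _ ih => exact impR (ih (Multiset.cons_le_cons _ hle))
  | boxR _ ih => exact boxR (ih (boxInv_mono hle))
  | diaL h hw _ ih =>
    exact diaL (Multiset.mem_of_le hle h) hw (ih (Multiset.cons_le_cons _ (boxInv_mono hle)))
  | andL _ ih =>
    obtain ⟨u, rfl, hu⟩ := exists_cons_of_cons_le hle
    exact andL (ih (Multiset.cons_le_cons _ (Multiset.cons_le_cons _ hu)))
  | orL _ _ ih₁ ih₂ =>
    obtain ⟨u, rfl, hu⟩ := exists_cons_of_cons_le hle
    exact orL (ih₁ (Multiset.cons_le_cons _ hu)) (ih₂ (Multiset.cons_le_cons _ hu))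
  | andImpL _ ih =>
    obtain ⟨u, rfl, hu⟩ := exists_cons_of_cons_le hle
    exact andImpL (ih (Multiset.cons_le_cons _ hu))
  | orImpL _ ih =>
    obtain ⟨u, rfl, hu⟩ := exists_cons_of_cons_le hle
    exact orImpL (ih (Multiset.cons_le_cons _ (Multiset.cons_le_cons _ hu)))
  | pImpL h _ ih =>
    obtain ⟨u, rfl, hu⟩ := exists_cons_of_cons_le hle
    exact pImpL (Multiset.mem_of_le hu h) (ih (Multiset.cons_le_cons _ hu))
  | impImpL _ _ ih₁ ih₂ =>
    obtain ⟨u, rfl, hu⟩ := exists_cons_of_cons_le hle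
    exact impImpL (ih₁ (Multiset.cons_le_cons _ hu)) (ih₂ (Multiset.cons_le_cons _ hu))
  | boxImpL _ _ ih₁ ih₂ =>
    obtain ⟨u, rfl, hu⟩ := exists_cons_of_cons_le hle
    exact boxImpL (ih₁ (boxInv_mono hu)) (ih₂ (Multiset.cons_le_cons _ hu))
  | diaImpL h _ _ ih₁ ih₂ =>
    obtain ⟨u, rfl, hu⟩ := exists_cons_of_cons_le hle
    exact diaImpL (Multiset.mem_of_le hu h) (ih₁ (Multiset.cons_le_cons _ (boxInv_mono hu)))
      (ih₂ (Multiset.cons_le_cons _ hu))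

theorem weaken {Γ : Multiset Form} {Δ : Option Form} (A : Form) (h : G4 w Γ Δ) :
    G4 w (A ::ₘ Γ) Δ :=
  h.mono (Multiset.le_cons_self _ _)

/-- Weakening on the right. -/
theorem of_none {Γ : Multiset Form} (h : G4 w Γ none) (Δ : Option Form) : G4 w Γ Δ := by
  generalize hΔ : none = Δ₀ at h
  induction h generalizing Δ with
  | botL h => exact botL h
  | idP | andR | orR1 | orR2 | impR | boxR => cases hΔ
  | diaL h hw _ ih =>
    subst hΔ
    exact diaL h (.inl (by simpa [diaInv] using hw)) (ih _ rfl)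
  | andL _ ih => exact andL (ih _ hΔ)
  | orL _ _ ih₁ ih₂ => exact orL (ih₁ _ hΔ) (ih₂ _ hΔ)
  | andImpL _ ih => exact andImpL (ih _ hΔ)
  | orImpL _ ih => exact orImpL (ih _ hΔ)
  | pImpL h _ ih => exact pImpL h (ih _ hΔ)
  | impImpL h _ _ ih => exact impImpL h (ih _ hΔ)
  | boxImpL h _ _ ih => exact boxImpL h (ih _ hΔ)
  | diaImpL h h' _ _ ih => exact diaImpL h h' (ih _ hΔ)

/-- The premises of the left rule whose principal formula is a given conjunction, disjunction or
implication. -/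
def LeftPremises (w : Prop) : Form → Multiset Form → Option Form → Prop
  | .and φ ψ, Γ, Δ => G4 w (φ ::ₘ ψ ::ₘ Γ) Δ
  | .or φ ψ, Γ, Δ => G4 w (φ ::ₘ Γ) Δ ∧ G4 w (ψ ::ₘ Γ) Δ
  | .imp (.and φ ψ) χ, Γ, Δ => G4 w (φ.imp (ψ.imp χ) ::ₘ Γ) Δ
  | .imp (.or φ ψ) χ, Γ, Δ => G4 w (φ.imp χ ::ₘ ψ.imp χ ::ₘ Γ) Δ
  | .imp (.imp φ ψ) χ, Γ, Δ => G4 w (ψ.imp χ ::ₘ Γ) (some (φ.imp ψ)) ∧ G4 w (χ ::ₘ Γ) Δ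
  | .imp (.var _) ψ, Γ, Δ => G4 w (ψ ::ₘ Γ) Δ
  | .imp (.box _) ψ, Γ, Δ => G4 w (ψ ::ₘ Γ) Δ
  | .imp (.dia _) ψ, Γ, Δ => G4 w (ψ ::ₘ Γ) Δ
  | _, _, _ => False

/-- Formulas whose outermost connective is `∧`, `∨` or `→`. -/
def IsCompound : Form → Prop
  | .and _ _ | .or _ _ | .imp _ _ => True
  | _ => False

theorem IsCompound.unboxF_eq_none {A : Form} (hA : IsCompound A) : unboxF A = none := by
  cases A <;> first | rfl | exact hA.elim

/-- A compound antecedent formula `A` may be replaced by `M` as soon as this is possible in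
conclusions of the left rule for `A`. -/
theorem replace {A : Form} {M : Multiset Form} (hA : IsCompound A)
    (hp : ∀ Γ Δ, LeftPremises w A Γ Δ → G4 w (M + Γ) Δ) {Γ : Multiset Form} {Δ : Option Form}
    (h : G4 w (A ::ₘ Γ) Δ) : G4 w (M + Γ) Δ := by
  have mem {B : Form} {Γ : Multiset Form} (hB : ¬ IsCompound B) (h : B ∈ A ::ₘ Γ) : B ∈ M + Γ := by
    rcases Multiset.mem_cons.1 h with rfl | h
    · exact absurd hA hB
    · exact Multiset.mem_add.2 (.inr h)
  have unbox (Γ : Multiset Form) : boxInv (A ::ₘ Γ) = boxInv Γ :=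
    boxInv_cons_of_unboxF hA.unboxF_eq_none Γ
  generalize hS : A ::ₘ Γ = S at h
  induction h generalizing Γ with
  | botL h => subst hS; exact botL (mem id h)
  | idP h => subst hS; exact idP (mem id h)
  | andR _ _ ih₁ ih₂ => exact andR (ih₁ hS) (ih₂ hS)
  | orR1 _ ih => exact orR1 (ih hS)
  | orR2 _ ih => exact orR2 (ih hS)
  | impR _ ih =>
    subst hS
    exact impR (ih (Multiset.cons_swap ..)).exch
  | boxR h _ =>
    subst hS
    rw [unbox] at h
    exact boxR (h.mono le_boxInv_add)
  | diaL hm hw h _ =>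
    subst hS
    rw [unbox] at h
    exact diaL (mem id hm) hw (h.mono (Multiset.cons_le_cons _ le_boxInv_add))
  | andL h ih =>
    rcases Multiset.cons_eq_cons.1 hS with ⟨rfl, rfl⟩ | ⟨-, u, rfl, rfl⟩
    · exact hp _ _ h
    · rw [Multiset.add_cons]
      exact andL (ih (cons_rotate_three ..)).exch
  | orL h₁ h₂ ih₁ ih₂ =>
    rcases Multiset.cons_eq_cons.1 hS with ⟨rfl, rfl⟩ | ⟨-, u, rfl, rfl⟩
    · exact hp _ _ ⟨h₁, h₂⟩
    · rw [Multiset.add_cons]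
      exact orL (ih₁ (Multiset.cons_swap ..)).exch (ih₂ (Multiset.cons_swap ..)).exch
  | andImpL h ih =>
    rcases Multiset.cons_eq_cons.1 hS with ⟨rfl, rfl⟩ | ⟨-, u, rfl, rfl⟩
    · exact hp _ _ h
    · rw [Multiset.add_cons]
      exact andImpL (ih (Multiset.cons_swap ..)).exch
  | orImpL h ih =>
    rcases Multiset.cons_eq_cons.1 hS with ⟨rfl, rfl⟩ | ⟨-, u, rfl, rfl⟩
    · exact hp _ _ h
    · rw [Multiset.add_cons]
      exact orImpL (ih (cons_rotate_three ..)).exch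
  | pImpL hm h ih =>
    rcases Multiset.cons_eq_cons.1 hS with ⟨rfl, rfl⟩ | ⟨-, u, rfl, rfl⟩
    · exact hp _ _ h
    · rw [Multiset.add_cons]
      exact pImpL (mem id hm) (ih (Multiset.cons_swap ..)).exch
  | impImpL h₁ h₂ ih₁ ih₂ =>
    rcases Multiset.cons_eq_cons.1 hS with ⟨rfl, rfl⟩ | ⟨-, u, rfl, rfl⟩
    · exact hp _ _ ⟨h₁, h₂⟩
    · rw [Multiset.add_cons]
      exact impImpL (ih₁ (Multiset.cons_swap ..)).exch (ih₂ (Multiset.cons_swap ..)).exch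
  | boxImpL h₁ h₂ _ ih =>
    rcases Multiset.cons_eq_cons.1 hS with ⟨rfl, rfl⟩ | ⟨-, u, rfl, rfl⟩
    · exact hp _ _ h₂
    · rw [Multiset.add_cons]
      rw [unbox] at h₁
      exact boxImpL (h₁.mono le_boxInv_add) (ih (Multiset.cons_swap ..)).exch
  | diaImpL hm h₁ h₂ _ ih =>
    rcases Multiset.cons_eq_cons.1 hS with ⟨rfl, rfl⟩ | ⟨-, u, rfl, rfl⟩
    · exact hp _ _ h₂
    · rw [Multiset.add_cons]
      rw [unbox] at h₁
      exact diaImpL (mem id hm) (h₁.mono (Multiset.cons_le_cons _ le_boxInv_add))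
        (ih (Multiset.cons_swap ..)).exch

variable {Γ : Multiset Form} {Δ : Option Form} {φ ψ χ : Form}

theorem and_inv (h : G4 w (φ.and ψ ::ₘ Γ) Δ) : G4 w (φ ::ₘ ψ ::ₘ Γ) Δ :=
  (replace (A := φ.and ψ) (M := φ ::ₘ {ψ}) trivial
    (fun _ _ h => exch (Γ := _ ::ₘ _ ::ₘ _) h) h).exch

theorem or_inv_left (h : G4 w (φ.or ψ ::ₘ Γ) Δ) : G4 w (φ ::ₘ Γ) Δ :=
  replace (A := φ.or ψ) (M := {φ}) trivial (fun _ _ h => h.1) h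

theorem or_inv_right (h : G4 w (φ.or ψ ::ₘ Γ) Δ) : G4 w (ψ ::ₘ Γ) Δ :=
  replace (A := φ.or ψ) (M := {ψ}) trivial (fun _ _ h => h.2) h

theorem andImp_inv (h : G4 w ((φ.and ψ).imp χ ::ₘ Γ) Δ) : G4 w (φ.imp (ψ.imp χ) ::ₘ Γ) Δ :=
  replace (A := (φ.and ψ).imp χ) (M := {φ.imp (ψ.imp χ)}) trivial (fun _ _ h => h) h

theorem orImp_inv (h : G4 w ((φ.or ψ).imp χ ::ₘ Γ) Δ) :
    G4 w (φ.imp χ ::ₘ ψ.imp χ ::ₘ Γ) Δ :=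
  (replace (A := (φ.or ψ).imp χ) (M := φ.imp χ ::ₘ {ψ.imp χ}) trivial
    (fun _ _ h => exch (Γ := _ ::ₘ _ ::ₘ _) h) h).exch

theorem varImp_inv {n : ℕ} (h : G4 w ((Form.var n).imp χ ::ₘ Γ) Δ) : G4 w (χ ::ₘ Γ) Δ :=
  replace (A := (Form.var n).imp χ) (M := {χ}) trivial (fun _ _ h => h) h

theorem boxImp_inv (h : G4 w (φ.box.imp χ ::ₘ Γ) Δ) : G4 w (χ ::ₘ Γ) Δ :=
  replace (A := φ.box.imp χ) (M := {χ}) trivial (fun _ _ h => h) h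

theorem diaImp_inv (h : G4 w (φ.dia.imp χ ::ₘ Γ) Δ) : G4 w (χ ::ₘ Γ) Δ :=
  replace (A := φ.dia.imp χ) (M := {χ}) trivial (fun _ _ h => h) h

theorem impImp_inv_right (h : G4 w ((φ.imp ψ).imp χ ::ₘ Γ) Δ) : G4 w (χ ::ₘ Γ) Δ :=
  replace (A := (φ.imp ψ).imp χ) (M := {χ}) trivial (fun _ _ h => h.2) h

/-- The rule `→R` is invertible. -/
theorem impR_inv (h : G4 w Γ (some (φ.imp ψ))) : G4 w (φ ::ₘ Γ) (some ψ) := by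
  generalize hΔ : some (φ.imp ψ) = Δ at h
  induction h with
  | botL h => exact botL (Multiset.mem_cons_of_mem h)
  | idP | andR | orR1 | orR2 | boxR => cases hΔ
  | impR h => cases hΔ; exact h
  | diaL hm hw h =>
    subst hΔ
    exact diaL (Multiset.mem_cons_of_mem hm) (.inl (by simpa [diaInv] using hw))
      ((of_none h _).mono (Multiset.cons_le_cons _ (boxInv_mono (Multiset.le_cons_self _ _))))
  | andL _ ih =>
    rw [Multiset.cons_swap]
    exact andL (ih hΔ).exch
  | orL _ _ ih₁ ih₂ =>
    rw [Multiset.cons_swap]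
    exact orL (ih₁ hΔ).exch (ih₂ hΔ).exch
  | andImpL _ ih =>
    rw [Multiset.cons_swap]
    exact andImpL (ih hΔ).exch
  | orImpL _ ih =>
    rw [Multiset.cons_swap]
    exact orImpL (ih hΔ).exch
  | pImpL hm _ ih =>
    rw [Multiset.cons_swap]
    exact pImpL (Multiset.mem_cons_of_mem hm) (ih hΔ).exch
  | impImpL h _ _ ih =>
    rw [Multiset.cons_swap]
    exact impImpL (h.weaken φ).exch (ih hΔ).exch
  | boxImpL h _ _ ih =>
    rw [Multiset.cons_swap]
    exact boxImpL (h.mono (boxInv_mono (Multiset.le_cons_self _ _))) (ih hΔ).exch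
  | diaImpL hm h _ _ ih =>
    rw [Multiset.cons_swap]
    exact diaImpL (Multiset.mem_cons_of_mem hm)
      (h.mono (Multiset.cons_le_cons _ (boxInv_mono (Multiset.le_cons_self _ _))))
      (ih hΔ).exch

/-- The context-sharing left implication rule is admissible. -/
theorem impL (h : G4 w Γ (some φ)) (h' : G4 w (χ ::ₘ Γ) Δ) : G4 w (φ.imp χ ::ₘ Γ) Δ := by
  generalize hφ : some φ = Δ₀ at h
  induction h generalizing φ χ Δ with
  | botL h => exact botL (Multiset.mem_cons_of_mem h)
  | idP h => cases hφ; exact pImpL h h'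
  | andR _ _ ih₁ ih₂ => cases hφ; exact andImpL (ih₁ (ih₂ h' rfl) rfl)
  | orR1 _ ih =>
    cases hφ
    exact orImpL ((ih h' rfl).mono (Multiset.cons_le_cons _ (Multiset.le_cons_self _ _)))
  | orR2 _ ih => cases hφ; exact orImpL ((ih h' rfl).weaken _)
  | impR h => cases hφ; exact impImpL ((impR h).weaken _) h'
  | boxR h => cases hφ; exact boxImpL h h'
  | diaL hm hw h =>
    subst hφ
    cases φ with
    | dia φ => exact diaImpL hm h h'
    | _ =>
      exact diaL (Multiset.mem_cons_of_mem hm) (.inl (by simpa [diaInv] using hw))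
        (by simpa using of_none h _)
  | andL _ ih =>
    rw [Multiset.cons_swap] at h' ⊢
    exact andL (ih h'.and_inv.exch hφ).exch
  | orL _ _ ih₁ ih₂ =>
    rw [Multiset.cons_swap] at h' ⊢
    exact orL (ih₁ h'.or_inv_left.exch hφ).exch (ih₂ h'.or_inv_right.exch hφ).exch
  | andImpL _ ih =>
    rw [Multiset.cons_swap] at h' ⊢
    exact andImpL (ih h'.andImp_inv.exch hφ).exch
  | orImpL _ ih =>
    rw [Multiset.cons_swap] at h' ⊢
    exact orImpL (ih h'.orImp_inv.exch hφ).exch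
  | pImpL hm _ ih =>
    rw [Multiset.cons_swap] at h' ⊢
    exact pImpL (Multiset.mem_cons_of_mem hm) (ih h'.varImp_inv.exch hφ).exch
  | impImpL h _ _ ih =>
    rw [Multiset.cons_swap] at h' ⊢
    exact impImpL (h.weaken (φ.imp χ)).exch (ih h'.impImp_inv_right.exch hφ).exch
  | boxImpL h _ _ ih =>
    rw [Multiset.cons_swap] at h' ⊢
    exact boxImpL (by simpa using h) (ih h'.boxImp_inv.exch hφ).exch
  | diaImpL hm h _ _ ih =>
    rw [Multiset.cons_swap] at h' ⊢
    exact diaImpL (Multiset.mem_cons_of_mem hm) (by simpa using h)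
      (ih h'.diaImp_inv.exch hφ).exch

theorem impImp_inv_left (h : G4 w ((φ.imp ψ).imp χ ::ₘ Γ) Δ) :
    G4 w (φ ::ₘ ψ.imp χ ::ₘ ψ.imp χ ::ₘ Γ) Δ :=
  (replace (A := (φ.imp ψ).imp χ) (M := φ ::ₘ ψ.imp χ ::ₘ {ψ.imp χ}) trivial
    (fun Γ _ h => (impL (χ := χ) (Γ := φ ::ₘ ψ.imp χ ::ₘ Γ) h.1.impR_inv
      ((h.2.weaken (ψ.imp χ)).weaken φ).exch).exch) h).exch

/-- The weight of a formula, for which every premise of a left rule is lighter than its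
conclusion. -/
def weight : Form → ℕ
  | .var _ | .bot => 1
  | .and φ ψ | .or φ ψ => weight φ + weight ψ + 2
  | .imp φ ψ => weight φ + weight ψ + 1
  | .box φ | .dia φ => weight φ + 1

theorem contract_boxInv {A : Form} {M : Multiset Form}
    (IH : ∀ B, weight B < weight A → ∀ Γ Δ, G4 w (B ::ₘ B ::ₘ Γ) Δ → G4 w (B ::ₘ Γ) Δ)
    (h : G4 w (M + boxInv (A ::ₘ A ::ₘ Γ)) Δ) : G4 w (M + boxInv (A ::ₘ Γ)) Δ := by
  by_cases hA : unboxF A = none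
  · simpa only [boxInv_cons_of_unboxF hA] using h
  · cases A with
    | box B =>
      rw [boxInv_cons_box, boxInv_cons_box] at h
      rw [boxInv_cons_box]
      exact (IH B (Nat.lt_succ_self _) (M + boxInv Γ) Δ h.exch).exch
    | _ => exact absurd rfl hA

theorem contract (A : Form) (Γ : Multiset Form) (Δ : Option Form)
    (h : G4 w (A ::ₘ A ::ₘ Γ) Δ) : G4 w (A ::ₘ Γ) Δ := by
  induction hn : weight A using Nat.strong_induction_on generalizing A Γ Δ with
  | _ n IH =>
  subst hn
  replace IH : ∀ B, weight B < weight A → ∀ Γ Δ, G4 w (B ::ₘ B ::ₘ Γ) Δ → G4 w (B ::ₘ Γ) Δ :=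
    fun B hB Γ Δ h => IH _ hB B Γ Δ h rfl
  have mem {B : Form} {Γ : Multiset Form} (h : B ∈ A ::ₘ A ::ₘ Γ) : B ∈ A ::ₘ Γ := by
    simpa using h
  have unbox {Γ Δ} (h : G4 w (boxInv (A ::ₘ A ::ₘ Γ)) Δ) : G4 w (boxInv (A ::ₘ Γ)) Δ := by
    simpa using contract_boxInv (M := 0) IH (by simpa using h)
  have unbox_cons {B Γ Δ} (h : G4 w (B ::ₘ boxInv (A ::ₘ A ::ₘ Γ)) Δ) :
      G4 w (B ::ₘ boxInv (A ::ₘ Γ)) Δ :=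
    contract_boxInv (M := {B}) IH h
  generalize hS : A ::ₘ A ::ₘ Γ = S at h
  induction h generalizing Γ with
  | botL h => subst hS; exact botL (mem h)
  | idP h => subst hS; exact idP (mem h)
  | andR _ _ ih₁ ih₂ => exact andR (ih₁ _ hS) (ih₂ _ hS)
  | orR1 _ ih => exact orR1 (ih _ hS)
  | orR2 _ ih => exact orR2 (ih _ hS)
  | impR _ ih => subst hS; exact impR (ih _ (cons_rotate_three ..).symm).exch
  | boxR h _ => subst hS; exact boxR (unbox h)
  | diaL hm hw h _ => subst hS; exact diaL (mem hm) hw (unbox_cons h)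
  | @andL _ φ ψ _ h ih =>
    rcases cons_eq_cons_cons_self hS.symm with ⟨rfl, rfl⟩ | ⟨u, rfl, rfl⟩
    · rw [← cons_rotate_three] at h
      have h := h.and_inv
      exact andL (IH φ (by simp only [weight]; lia) _ _
        (IH ψ (by simp only [weight]; lia) (φ ::ₘ φ ::ₘ Γ) _ h.exch).exch)
    · rw [Multiset.cons_swap]
      exact andL (ih _ (cons_rotate_four ..)).exch
  | orL h₁ h₂ ih₁ ih₂ =>
    rcases cons_eq_cons_cons_self hS.symm with ⟨rfl, rfl⟩ | ⟨u, rfl, rfl⟩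
    · rw [Multiset.cons_swap] at h₁ h₂
      exact orL (IH _ (by simp only [weight]; lia) _ _ h₁.or_inv_left)
        (IH _ (by simp only [weight]; lia) _ _ h₂.or_inv_right)
    · rw [Multiset.cons_swap]
      exact orL (ih₁ _ (cons_rotate_three ..).symm).exch (ih₂ _ (cons_rotate_three ..).symm).exch
  | andImpL h ih =>
    rcases cons_eq_cons_cons_self hS.symm with ⟨rfl, rfl⟩ | ⟨u, rfl, rfl⟩
    · rw [Multiset.cons_swap] at h
      exact andImpL (IH _ (by simp only [weight]; lia) _ _ h.andImp_inv)
    · rw [Multiset.cons_swap]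
      exact andImpL (ih _ (cons_rotate_three ..).symm).exch
  | @orImpL _ φ ψ χ _ h ih =>
    rcases cons_eq_cons_cons_self hS.symm with ⟨rfl, rfl⟩ | ⟨u, rfl, rfl⟩
    · rw [← cons_rotate_three] at h
      have h := h.orImp_inv
      exact orImpL (IH (φ.imp χ) (by simp only [weight]; lia) _ _
        (IH (ψ.imp χ) (by simp only [weight]; lia) (φ.imp χ ::ₘ φ.imp χ ::ₘ Γ) _ h.exch).exch)
    · rw [Multiset.cons_swap]
      exact orImpL (ih _ (cons_rotate_four ..)).exch
  | pImpL hm h ih =>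
    rcases cons_eq_cons_cons_self hS.symm with ⟨rfl, rfl⟩ | ⟨u, rfl, rfl⟩
    · rw [Multiset.cons_swap] at h
      exact pImpL (by simpa using hm) (IH _ (by simp only [weight]; lia) _ _ h.varImp_inv)
    · rw [Multiset.cons_swap]
      exact pImpL (mem hm) (ih _ (cons_rotate_three ..).symm).exch
  | @impImpL _ φ ψ χ _ h₁ h₂ ih₁ ih₂ =>
    rcases cons_eq_cons_cons_self hS.symm with ⟨rfl, rfl⟩ | ⟨u, rfl, rfl⟩
    · rw [Multiset.cons_swap] at h₂
      refine impImpL (impR ?_) (IH _ (by simp only [weight]; lia) _ _ h₂.impImp_inv_right)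
      have h := h₁.impR_inv
      rw [← cons_rotate_three] at h
      have h : G4 w (φ ::ₘ φ ::ₘ ψ.imp χ ::ₘ ψ.imp χ ::ₘ ψ.imp χ ::ₘ Γ) (some ψ) :=
        h.impImp_inv_left.exch
      have h := IH φ (by simp only [weight]; lia) _ _ h
      have h := IH (ψ.imp χ) (by simp only [weight]; lia) (φ ::ₘ ψ.imp χ ::ₘ Γ) _ h.exch
      exact (IH (ψ.imp χ) (by simp only [weight]; lia) (φ ::ₘ Γ) _ h.exch).exch
    · rw [Multiset.cons_swap]
      exact impImpL (ih₁ _ (cons_rotate_three ..).symm).exch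
        (ih₂ _ (cons_rotate_three ..).symm).exch
  | boxImpL h₁ h₂ _ ih =>
    rcases cons_eq_cons_cons_self hS.symm with ⟨rfl, rfl⟩ | ⟨u, rfl, rfl⟩
    · rw [Multiset.cons_swap] at h₂
      exact boxImpL (by simpa using h₁) (IH _ (by simp only [weight]; lia) _ _ h₂.boxImp_inv)
    · rw [Multiset.cons_swap]
      exact boxImpL (unbox h₁) (ih _ (cons_rotate_three ..).symm).exch
  | diaImpL hm h₁ h₂ _ ih =>
    rcases cons_eq_cons_cons_self hS.symm with ⟨rfl, rfl⟩ | ⟨u, rfl, rfl⟩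
    · rw [Multiset.cons_swap] at h₂
      exact diaImpL (by simpa using hm) (by simpa using h₁)
        (IH _ (by simp only [weight]; lia) _ _ h₂.diaImp_inv)
    · rw [Multiset.cons_swap]
      exact diaImpL (mem hm) (unbox_cons h₁) (ih _ (cons_rotate_three ..).symm).exch

end G4

theorem G4CK.toG4 {Γ : Multiset Form} {δ : Form} (h : G4CK Γ δ) : G4 False Γ (some δ) := by
  induction h with
  | botL => exact .botL (Multiset.mem_cons_self _ _)
  | idP => exact .idP (Multiset.mem_cons_self _ _)
  | andL _ _ _ _ _ ih => exact .andL ih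
  | andR _ _ _ _ _ ih₁ ih₂ => exact .andR ih₁ ih₂
  | orL _ _ _ _ _ _ ih₁ ih₂ => exact .orL ih₁ ih₂
  | orR1 _ _ _ _ ih => exact .orR1 ih
  | orR2 _ _ _ _ ih => exact .orR2 ih
  | impR _ _ _ _ ih => exact .impR ih
  | andImpL _ _ _ _ _ _ ih => exact .andImpL ih
  | orImpL _ _ _ _ _ _ ih => exact .orImpL ih
  | pImpL _ _ _ _ _ ih =>
    rw [Multiset.cons_swap] at ih ⊢
    exact .pImpL (Multiset.mem_cons_self _ _) ih
  | impImpL _ _ _ _ _ _ _ ih₁ ih₂ => exact .impImpL ih₁ ih₂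
  | boxR _ _ _ ih => exact .boxR ih
  | boxImpL _ _ _ _ _ _ ih₁ ih₂ => exact .boxImpL ih₁ ih₂
  | diaImpL _ _ _ _ _ _ _ ih₁ ih₂ =>
    exact .diaImpL (Multiset.mem_cons_self _ _) (by simpa using ih₁) ih₂
  | diaL _ _ _ _ ih =>
    exact .diaL (Multiset.mem_cons_self _ _) (.inr rfl) (by simpa [diaInv] using ih)

theorem G4.toG4CK {Γ : Multiset Form} {δ : Form} (h : G4 False Γ (some δ)) : G4CK Γ δ := by
  generalize hΔ : some δ = Δ at h
  induction h generalizing δ with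
  | botL h => obtain ⟨_, rfl⟩ := Multiset.exists_cons_of_mem h; exact .botL _ _
  | idP h => cases hΔ; obtain ⟨_, rfl⟩ := Multiset.exists_cons_of_mem h; exact .idP _ _
  | andL _ ih => exact .andL _ _ _ _ (ih hΔ)
  | andR _ _ ih₁ ih₂ => cases hΔ; exact .andR _ _ _ (ih₁ rfl) (ih₂ rfl)
  | orL _ _ ih₁ ih₂ => exact .orL _ _ _ _ (ih₁ hΔ) (ih₂ hΔ)
  | orR1 _ ih => cases hΔ; exact .orR1 _ _ _ (ih rfl)
  | orR2 _ ih => cases hΔ; exact .orR2 _ _ _ (ih rfl)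
  | impR _ ih => cases hΔ; exact .impR _ _ _ (ih rfl)
  | andImpL _ ih => exact .andImpL _ _ _ _ _ (ih hΔ)
  | orImpL _ ih => exact .orImpL _ _ _ _ _ (ih hΔ)
  | pImpL h _ ih =>
    obtain ⟨_, rfl⟩ := Multiset.exists_cons_of_mem h
    rw [Multiset.cons_swap]
    exact .pImpL _ _ _ _ (Multiset.cons_swap _ _ _ ▸ ih hΔ)
  | impImpL _ _ ih₁ ih₂ => exact .impImpL _ _ _ _ _ (ih₁ rfl) (ih₂ hΔ)
  | boxR _ ih => cases hΔ; exact .boxR _ _ (ih rfl)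
  | boxImpL _ _ ih₁ ih₂ => exact .boxImpL _ _ _ _ (ih₁ rfl) (ih₂ hΔ)
  | diaImpL h _ _ ih₁ ih₂ =>
    obtain ⟨_, rfl⟩ := Multiset.exists_cons_of_mem h
    exact .diaImpL _ _ _ _ _ (by simpa using ih₁ rfl) (ih₂ hΔ)
  | diaL h hw _ ih =>
    subst hΔ
    obtain ⟨_, rfl⟩ := Multiset.exists_cons_of_mem h
    cases δ with
    | dia δ => exact .diaL _ _ _ (by simpa using ih rfl)
    | _ => simp [diaInv] at hw

theorem G4WK.toG4 {Γ : Multiset Form} {Δ : Option Form} (h : G4WK Γ Δ) : G4 True Γ Δ := by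
  induction h with
  | botL => exact .botL (Multiset.mem_cons_self _ _)
  | idP => exact .idP (Multiset.mem_cons_self _ _)
  | andL _ _ _ _ _ ih => exact .andL ih
  | andR _ _ _ _ _ ih₁ ih₂ => exact .andR ih₁ ih₂
  | orL _ _ _ _ _ _ ih₁ ih₂ => exact .orL ih₁ ih₂
  | orR1 _ _ _ _ ih => exact .orR1 ih
  | orR2 _ _ _ _ ih => exact .orR2 ih
  | impR _ _ _ _ ih => exact .impR ih
  | andImpL _ _ _ _ _ _ ih => exact .andImpL ih
  | orImpL _ _ _ _ _ _ ih => exact .orImpL ih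
  | pImpL _ _ _ _ _ ih =>
    rw [Multiset.cons_swap] at ih ⊢
    exact .pImpL (Multiset.mem_cons_self _ _) ih
  | impImpL _ _ _ _ _ _ _ ih₁ ih₂ => exact .impImpL ih₁ ih₂
  | boxR _ _ _ ih => exact .boxR ih
  | boxImpL _ _ _ _ _ _ ih₁ ih₂ => exact .boxImpL ih₁ ih₂
  | diaImpL _ _ _ _ _ _ _ ih₁ ih₂ =>
    exact .diaImpL (Multiset.mem_cons_self _ _) (by simpa using ih₁) ih₂
  | diaL' _ _ _ _ ih => exact .diaL (Multiset.mem_cons_self _ _) (.inl trivial) (by simpa using ih)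

theorem G4.toG4WK {Γ : Multiset Form} {Δ : Option Form} (h : G4 True Γ Δ) : G4WK Γ Δ := by
  induction h with
  | botL h => obtain ⟨_, rfl⟩ := Multiset.exists_cons_of_mem h; exact .botL _ _
  | idP h => obtain ⟨_, rfl⟩ := Multiset.exists_cons_of_mem h; exact .idP _ _
  | andL _ ih => exact .andL _ _ _ _ ih
  | andR _ _ ih₁ ih₂ => exact .andR _ _ _ ih₁ ih₂
  | orL _ _ ih₁ ih₂ => exact .orL _ _ _ _ ih₁ ih₂
  | orR1 _ ih => exact .orR1 _ _ _ ih
  | orR2 _ ih => exact .orR2 _ _ _ ih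
  | impR _ ih => exact .impR _ _ _ ih
  | andImpL _ ih => exact .andImpL _ _ _ _ _ ih
  | orImpL _ ih => exact .orImpL _ _ _ _ _ ih
  | pImpL h _ ih =>
    obtain ⟨_, rfl⟩ := Multiset.exists_cons_of_mem h
    rw [Multiset.cons_swap]
    exact .pImpL _ _ _ _ (Multiset.cons_swap _ _ _ ▸ ih)
  | impImpL _ _ ih₁ ih₂ => exact .impImpL _ _ _ _ _ ih₁ ih₂
  | boxR _ ih => exact .boxR _ _ ih
  | boxImpL _ _ ih₁ ih₂ => exact .boxImpL _ _ _ _ ih₁ ih₂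
  | diaImpL h _ _ ih₁ ih₂ =>
    obtain ⟨_, rfl⟩ := Multiset.exists_cons_of_mem h
    exact .diaImpL _ _ _ _ _ (by simpa using ih₁) ih₂
  | diaL h _ _ ih =>
    obtain ⟨_, rfl⟩ := Multiset.exists_cons_of_mem h
    exact .diaL' _ _ _ (by simpa using ih)

/-- The contraction rule is admissible in both G4CK and G4WK:
from Γ,ψ,ψ ⇒ Δ infer Γ,ψ ⇒ Δ. -/
theorem contraction_admissible :
    (∀ (Γ : Multiset Form) (ψ δ : Form),
      G4CK (ψ ::ₘ ψ ::ₘ Γ) δ → G4CK (ψ ::ₘ Γ) δ) ∧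
    (∀ (Γ : Multiset Form) (ψ : Form) (Δ : Option Form),
      G4WK (ψ ::ₘ ψ ::ₘ Γ) Δ → G4WK (ψ ::ₘ Γ) Δ) := by
  exact ⟨fun Γ ψ _ h => (h.toG4.contract ψ Γ _).toG4CK,
    fun Γ ψ _ h => (h.toG4.contract ψ Γ _).toG4WK⟩
end
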